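/- arXiv:1912.10936 — 2 statements merged into one kernel-verified Lean document; each statement's English description precedes it below -/
import Mathlib

section
/- Let μ ∈ M(ℝ^d;ℝ^d) with div μ = 0, and suppose there exists a finite non-negative Borel measure ξ on M(ℝ^d;ℝ^d) (with the weak-star topology) concentrated on the set {μ_γ/‖μ_γ‖ : γ Lipschitz curve with μ_γ ≠ 0} ∪ {0} such that μ = ∫ ν dξ(ν) and |μ| = ∫ |ν| dξ(ν). Then there exists a σ-finite non-negative Borel measure η on the space Γ of Lipschitz curves [0,1] → ℝ^d such that μ = ∫_Γ μ_γ dη(γ) and |μ| = ∫_Γ |μ_γ| dη(γ). -/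
open MeasureTheory Filter
open scoped ENNReal NNReal RealInnerProductSpace

noncomputable section

abbrev Ed (d : ℕ) : Type := EuclideanSpace ℝ (Fin d)

/-- A (Lipschitz) curve is a Lipschitz map `ℝ → ℝ^d`; only its restriction to `[0,1]` matters. -/
def IsLip {d : ℕ} (γ : ℝ → Ed d) : Prop := ∃ K : ℝ≥0, LipschitzWith K γ

/-- The space `Γ` of Lipschitz curves. -/
def Curve (d : ℕ) : Type := {γ : ℝ → Ed d // IsLip γ}

/-- Restriction of a curve to `[0,1]` as a continuous map; it induces the sup-norm topology
on the space of curves. -/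
def curveRestrict {d : ℕ} (γ : Curve d) : C(Set.Icc (0:ℝ) 1, Ed d) :=
  ⟨fun t => γ.1 t, by
    obtain ⟨K, hK⟩ := γ.2
    exact hK.continuous.comp continuous_subtype_val⟩

instance {d : ℕ} : TopologicalSpace (Curve d) :=
  TopologicalSpace.induced curveRestrict inferInstance

instance {d : ℕ} : MeasurableSpace (Curve d) := borel (Curve d)

/-- The pairing `⟨μ_γ, Φ⟩ = ∫₀¹ Φ(γ(t))·γ'(t) dt`. -/
def curvePair {d : ℕ} (γ : ℝ → Ed d) (Φ : Ed d → Ed d) : ℝ :=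
  ∫ t in (0:ℝ)..1, ⟪Φ (γ t), deriv γ t⟫

/-- The pairing `⟨|μ_γ|, f⟩ = ∫₀¹ f(γ(t)) ‖γ'(t)‖ dt`. -/
def curveMass {d : ℕ} (γ : ℝ → Ed d) (f : Ed d → ℝ) : ℝ :=
  ∫ t in (0:ℝ)..1, f (γ t) * ‖deriv γ t‖

/-- A finite `ℝ^d`-valued Borel measure on `ℝ^d`, given by its polar decomposition
`μ = τ|μ|` : a finite positive measure together with a unit-norm density. -/
structure VecMeas (d : ℕ) where
  pos : Measure (Ed d)
  finite : IsFiniteMeasure pos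
  dens : Ed d → Ed d
  meas : Measurable dens
  unit : ∀ᵐ x ∂pos, ‖dens x‖ = 1

/-- The pairing `⟨ν, Φ⟩` of a vector measure with a test vector field. -/
def VecMeas.pair {d : ℕ} (ν : VecMeas d) (Φ : Ed d → Ed d) : ℝ :=
  ∫ x, ⟪Φ x, ν.dens x⟫ ∂ν.pos

/-- The weak-star topology on `M(ℝ^d;ℝ^d)`, i.e. the initial topology with respect to the
pairings against all `C₀` vector fields. -/
instance {d : ℕ} : TopologicalSpace (VecMeas d) :=
  ⨅ Φ : {Φ : Ed d → Ed d // Continuous Φ ∧ Tendsto Φ (cocompact (Ed d)) (nhds 0)},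
    TopologicalSpace.induced (fun ν => VecMeas.pair ν Φ.1) inferInstance

instance {d : ℕ} : MeasurableSpace (VecMeas d) := borel (VecMeas d)

section Curves

variable {E : Type*} [NormedAddCommGroup E] [InnerProductSpace ℝ E]

lemma LipschitzWith.inner_deriv_le {γ : ℝ → E} (hγ : LipschitzWith 1 γ) (v : E) (t : ℝ) :
    |⟪v, deriv γ t⟫| ≤ ‖v‖ := by
  have h : ‖deriv γ t‖ ≤ 1 := by simpa using norm_deriv_le_of_lipschitz (x₀ := t) hγ
  calc |⟪v, deriv γ t⟫| ≤ ‖v‖ * ‖deriv γ t‖ := abs_real_inner_le_norm _ _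
    _ ≤ ‖v‖ := mul_le_of_le_one_right (norm_nonneg _) h

variable [FiniteDimensional ℝ E]

lemma LipschitzWith.intervalIntegrable_inner_deriv {γ : ℝ → E} (hγ : LipschitzWith 1 γ)
    {Ψ : ℝ → E} (hΨ : Continuous Ψ) (a b : ℝ) :
    IntervalIntegrable (fun t => ⟪Ψ t, deriv γ t⟫) volume a b := by
  borelize E
  have : Measurable fun t => ⟪Ψ t, deriv γ t⟫ := hΨ.measurable.inner (measurable_deriv γ)
  exact (hΨ.norm.intervalIntegrable a b).mono_fun' this.aestronglyMeasurable
    (ae_of_all _ fun t => hγ.inner_deriv_le _ t)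

lemma LipschitzWith.integral_inner_deriv {γ : ℝ → E} (hγ : LipschitzWith 1 γ) (c : E) (a b : ℝ) :
    ∫ t in a..b, ⟪c, deriv γ t⟫ = ⟪c, γ b - γ a⟫ := by
  have hL : LipschitzWith (‖innerSL ℝ c‖₊ * 1) (fun t => ⟪c, γ t⟫) :=
    (innerSL ℝ c).lipschitz.comp hγ
  rw [inner_sub_right,
    ← (hL.lipschitzOnWith (s := Set.uIcc a b)).absolutelyContinuousOnInterval.integral_deriv_eq_sub]
  refine intervalIntegral.integral_congr_ae ?_
  filter_upwards [hγ.ae_differentiableAt (μ := volume)] with t ht _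
  exact (((innerSL ℝ c).hasFDerivAt.comp_hasDerivAt t ht.hasDerivAt).deriv).symm

/-- Riemann sums approximate the action of a vector field, uniformly over `1`-Lipschitz curves. -/
lemma LipschitzWith.abs_integral_sub_riemannSum_le {γ : ℝ → E} (hγ : LipschitzWith 1 γ)
    {Φ : E → E} (hΦ : Continuous Φ) {n : ℕ} (hn : 0 < n) {ε : ℝ}
    (h : ∀ x y, dist x y ≤ 1 / (n : ℝ) → dist (Φ x) (Φ y) ≤ ε) :
    |(∫ t in (0:ℝ)..1, ⟪Φ (γ t), deriv γ t⟫) -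
      ∑ i ∈ Finset.range n, ⟪Φ (γ (i / n)), γ ((i + 1 : ℕ) / n) - γ (i / n)⟫| ≤ ε := by
  have hn' : (0:ℝ) < n := by exact_mod_cast hn
  have hsum : (∫ t in (0:ℝ)..1, ⟪Φ (γ t), deriv γ t⟫) =
      ∑ i ∈ Finset.range n, ∫ t in ((i:ℝ) / n)..((i + 1 : ℕ) / n), ⟪Φ (γ t), deriv γ t⟫ := by
    have := intervalIntegral.sum_integral_adjacent_intervals (μ := volume)
      (f := fun t => ⟪Φ (γ t), deriv γ t⟫) (a := fun i : ℕ => (i:ℝ) / n) (n := n)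
      (fun k _ => hγ.intervalIntegrable_inner_deriv (hΦ.comp hγ.continuous) _ _)
    rw [this]
    simp [hn'.ne']
  rw [hsum, ← Finset.sum_sub_distrib]
  calc _ ≤ ∑ i ∈ Finset.range n, |(∫ t in ((i:ℝ) / n)..((i + 1 : ℕ) / n),
          ⟪Φ (γ t), deriv γ t⟫) - ⟪Φ (γ (i / n)), γ ((i + 1 : ℕ) / n) - γ (i / n)⟫| :=
        Finset.abs_sum_le_sum_abs _ _
    _ ≤ ∑ i ∈ Finset.range n, ε * (1 / n) := by
        refine Finset.sum_le_sum fun i _ => ?_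
        have hle : (i:ℝ) / n ≤ ((i + 1 : ℕ) : ℝ) / n := by gcongr; simp
        have hlen : ((i + 1 : ℕ) : ℝ) / n - i / n = 1 / n := by push_cast; ring
        rw [← hγ.integral_inner_deriv, ← intervalIntegral.integral_sub
          (hγ.intervalIntegrable_inner_deriv (Ψ := fun t => Φ (γ t)) (hΦ.comp hγ.continuous) _ _)
          (hγ.intervalIntegrable_inner_deriv (Ψ := fun _ => Φ (γ (i / n))) continuous_const _ _)]
        rw [← Real.norm_eq_abs]
        refine (intervalIntegral.norm_integral_le_of_norm_le_const (C := ε) fun t ht => ?_).trans ?_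
        · rw [Set.uIoc_of_le hle] at ht
          rw [← inner_sub_left]
          refine (hγ.inner_deriv_le _ t).trans ?_
          rw [← dist_eq_norm]
          refine h _ _ ((hγ.dist_le_mul _ _).trans ?_)
          rw [NNReal.coe_one, one_mul, Real.dist_eq, abs_of_pos (sub_pos.2 ht.1)]
          linarith [ht.2]
        · rw [hlen, abs_of_pos (by positivity)]
    _ = ε := by simp; field_simp

end Curves

/-- `1`-Lipschitz curves parametrized by the unit interval, with the supremum distance. -/
abbrev UnitSpeedCurve (E : Type*) [NormedAddCommGroup E] : Type _ :=
  {γ : C(Set.Icc (0:ℝ) 1, E) // LipschitzWith 1 γ}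

namespace UnitSpeedCurve

variable {E : Type*} [NormedAddCommGroup E]

/-- Extension of a curve to the real line, constant outside of `[0,1]`. -/
def extend (γ : UnitSpeedCurve E) : ℝ → E := Set.IccExtend zero_le_one γ.1

lemma lipschitzWith_extend (γ : UnitSpeedCurve E) : LipschitzWith 1 γ.extend := by
  have h := γ.2.comp (LipschitzWith.projIcc (zero_le_one (α := ℝ)))
  rwa [one_mul] at h

lemma dist_extend_zero_le (γ : UnitSpeedCurve E) {t : ℝ} (ht : t ∈ Set.Icc (0:ℝ) 1) :
    dist (γ.extend t) (γ.extend 0) ≤ 1 := by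
  refine (γ.lipschitzWith_extend.dist_le_mul _ _).trans ?_
  simpa [abs_of_nonneg ht.1] using ht.2

lemma continuous_extend_uncurry :
    Continuous fun p : UnitSpeedCurve E × ℝ => p.1.extend p.2 := by
  refine (continuous_eval (F := C(Set.Icc (0:ℝ) 1, E))).comp
    ((continuous_subtype_val.comp continuous_fst).prodMk
      (continuous_projIcc (h := zero_le_one).comp continuous_snd))

lemma continuous_extend_apply (t : ℝ) : Continuous fun γ : UnitSpeedCurve E => γ.extend t :=
  continuous_extend_uncurry.comp (continuous_id.prodMk continuous_const)

lemma isClosed_setOf_lipschitzWith :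
    IsClosed {γ : C(Set.Icc (0:ℝ) 1, E) | LipschitzWith 1 γ} := by
  simp only [lipschitzWith_iff_dist_le_mul, Set.ofPred_forall]
  exact isClosed_iInter fun s => isClosed_iInter fun t => isClosed_le
    ((continuous_eval_const s).dist (continuous_eval_const t)) continuous_const

instance [ProperSpace E] : ProperSpace (UnitSpeedCurve E) := by
  refine ⟨fun γ r => ?_⟩
  rw [Topology.IsEmbedding.subtypeVal.isCompact_iff]
  let e := ContinuousMap.equivBoundedOfCompact (Set.Icc (0:ℝ) 1) E
  have he : Topology.IsEmbedding e :=
    (ContinuousMap.isUniformEmbedding_equivBoundedOfCompact _ _).isEmbedding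
  rw [he.isCompact_iff]
  have hcl : IsClosed (e '' (Subtype.val '' Metric.closedBall γ r)) := by
    have h1 : IsClosed (Subtype.val '' Metric.closedBall γ r) :=
      isClosed_setOf_lipschitzWith.isClosedEmbedding_subtypeVal.isClosedMap _
        Metric.isClosed_closedBall
    exact (ContinuousMap.isometryEquivBoundedOfCompact (Set.Icc (0:ℝ) 1)
      E).toHomeomorph.isClosedMap _ h1
  refine BoundedContinuousFunction.arzela_ascoli₂
    (Metric.closedBall (γ.extend 0) (1 + r)) (isCompact_closedBall _ _) _ hcl ?_ ?_
  · rintro _ t ⟨_, ⟨γ', hγ', rfl⟩, rfl⟩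
    have h1 : dist (γ'.1 t) (γ.1 t) ≤ r :=
      (ContinuousMap.dist_apply_le_dist t).trans (Metric.mem_closedBall.1 hγ')
    have h2 : dist (γ.1 t) (γ.extend 0) ≤ 1 := by
      simpa [extend] using γ.dist_extend_zero_le t.2
    exact Metric.mem_closedBall.2
      ((dist_triangle _ (γ.1 t) _).trans (add_comm r 1 ▸ add_le_add h1 h2))
  · refine LipschitzWith.uniformEquicontinuous _ 1 ?_ |>.equicontinuous
    rintro ⟨_, _, ⟨γ', hγ', rfl⟩, rfl⟩
    exact γ'.2

lemma continuous_integral {f : E → ℝ} (hf : Continuous f) :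
    Continuous fun γ : UnitSpeedCurve E => ∫ t in (0:ℝ)..1, f (γ.extend t) :=
  intervalIntegral.continuous_parametric_intervalIntegral_of_continuous'
    (f := fun (γ : UnitSpeedCurve E) t => f (γ.extend t)) (hf.comp continuous_extend_uncurry) _ _

/-- The action of a curve for the vector field `Φ` and the potential `f`. -/
def action [InnerProductSpace ℝ E] (Φ : E → E) (f : E → ℝ) (γ : UnitSpeedCurve E) : ℝ :=
  (∫ t in (0:ℝ)..1, ⟪Φ (γ.extend t), deriv γ.extend t⟫) + ∫ t in (0:ℝ)..1, f (γ.extend t)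

variable [InnerProductSpace ℝ E] [FiniteDimensional ℝ E]

lemma continuous_integral_inner_deriv {Φ : E → E} (hΦ : Continuous Φ) (hc : HasCompactSupport Φ) :
    Continuous fun γ : UnitSpeedCurve E =>
      ∫ t in (0:ℝ)..1, ⟪Φ (γ.extend t), deriv γ.extend t⟫ := by
  refine continuous_of_uniform_approx_of_continuous fun u hu => ?_
  obtain ⟨ε, hε, hεu⟩ := Metric.mem_uniformity_dist.1 hu
  obtain ⟨δ, hδ, hδΦ⟩ := Metric.uniformContinuous_iff.1
    (hc.uniformContinuous_of_continuous hΦ) (ε / 2) (half_pos hε)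
  obtain ⟨n, hn⟩ := exists_nat_one_div_lt hδ
  refine ⟨fun γ => ∑ i ∈ Finset.range (n + 1), ⟪Φ (γ.extend (i / (n + 1 : ℕ))),
      γ.extend ((i + 1 : ℕ) / (n + 1 : ℕ)) - γ.extend (i / (n + 1 : ℕ))⟫, ?_, fun γ => hεu ?_⟩
  · exact continuous_finsetSum _ fun i _ => (hΦ.comp (continuous_extend_apply _)).inner
      ((continuous_extend_apply _).sub (continuous_extend_apply _))
  · rw [Real.dist_eq]
    refine (γ.lipschitzWith_extend.abs_integral_sub_riemannSum_le hΦ n.succ_pos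
      (ε := ε / 2) fun x y hxy => (hδΦ (hxy.trans_lt ?_)).le).trans_lt (half_lt_self hε)
    exact_mod_cast hn

lemma continuous_action {Φ : E → E} {f : E → ℝ} (hΦ : Continuous Φ) (hc : HasCompactSupport Φ)
    (hf : Continuous f) : Continuous (action Φ f) :=
  (continuous_integral_inner_deriv hΦ hc).add (continuous_integral hf)

lemma isCompact_setOf_extend_zero_norm_le (R : ℝ) :
    IsCompact {γ : UnitSpeedCurve E | ‖γ.extend 0‖ ≤ R} := by
  let γ₀ : UnitSpeedCurve E := ⟨0, LipschitzWith.const' 0⟩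
  refine Metric.isCompact_of_isClosed_isBounded
    (isClosed_le (continuous_extend_apply 0).norm continuous_const)
    ((Metric.isBounded_closedBall (x := γ₀) (r := R + 1)).subset fun γ hγ => ?_)
  have hR : 0 ≤ R := (norm_nonneg _).trans hγ
  refine Metric.mem_closedBall.2 ((ContinuousMap.dist_le (by linarith)).2 fun t => ?_)
  have h2 : dist (γ.1 t) (γ.extend 0) ≤ 1 := by
    simpa [extend] using γ.dist_extend_zero_le t.2
  refine (dist_triangle _ (γ.extend 0) _).trans ?_
  have h3 : dist (γ.extend 0) (γ₀.1 t) ≤ R := by simpa [γ₀] using hγ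
  linarith

lemma hasCompactSupport_action {Φ : E → E} {f : E → ℝ} (hc : HasCompactSupport Φ)
    (hcf : HasCompactSupport f) : HasCompactSupport (action Φ f) := by
  obtain ⟨R, hR⟩ := (hc.isCompact.isBounded.union hcf.isCompact.isBounded).subset_closedBall 0
  refine HasCompactSupport.intro (isCompact_setOf_extend_zero_norm_le (R + 1)) fun γ hγ => ?_
  have key : ∀ t ∈ Set.uIcc (0:ℝ) 1, Φ (γ.extend t) = 0 ∧ f (γ.extend t) = 0 := by
    intro t ht
    rw [Set.uIcc_of_le zero_le_one] at ht
    have h1 : γ.extend t ∉ Metric.closedBall (0 : E) R := by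
      intro h
      refine hγ ?_
      have h2 := γ.dist_extend_zero_le ht
      have h3 := dist_triangle (γ.extend 0) (γ.extend t) 0
      rw [dist_comm (γ.extend 0) (γ.extend t), dist_zero_right] at h3
      have h4 := Metric.mem_closedBall.1 h
      change ‖γ.extend 0‖ ≤ R + 1
      linarith
    exact ⟨image_eq_zero_of_notMem_tsupport fun h => h1 (hR (Or.inl h)),
      image_eq_zero_of_notMem_tsupport fun h => h1 (hR (Or.inr h))⟩
  rw [action, intervalIntegral.integral_congr (g := fun _ => (0:ℝ)) fun t ht => ?_,
    intervalIntegral.integral_congr (g := fun _ => (0:ℝ)) fun t ht => (key t ht).2]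
  · simp
  · simp [(key t ht).1]

end UnitSpeedCurve

section Duality

variable {E : Type*} [NormedAddCommGroup E] [InnerProductSpace ℝ E]

/-- The action integrand of the vector field `Φ` and the potential `f` along a curve. -/
def lagrangian (Φ : E → E) (f : E → ℝ) (γ : ℝ → E) (t : ℝ) : ℝ :=
  ⟪Φ (γ t), deriv γ t⟫ + f (γ t)

lemma abs_lagrangian_le {Φ : E → E} {f : E → ℝ} {C : ℝ} (hC : ∀ x, ‖Φ x‖ + |f x| ≤ C)
    {γ : ℝ → E} (hγ : LipschitzWith 1 γ) (t : ℝ) : |lagrangian Φ f γ t| ≤ C :=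
  (abs_add_le _ _).trans ((add_le_add_left (hγ.inner_deriv_le _ t) _).trans (hC _))

lemma lagrangian_comp_add_const (Φ : E → E) (f : E → ℝ) (γ : ℝ → E) (a t : ℝ) :
    lagrangian Φ f (fun s => γ (s + a)) t = lagrangian Φ f γ (t + a) := by
  simp [lagrangian, deriv_comp_add_const]

lemma lagrangian_congr {γ γ' : ℝ → E} {t : ℝ} (h : γ =ᶠ[nhds t] γ') (Φ : E → E) (f : E → ℝ) :
    lagrangian Φ f γ t = lagrangian Φ f γ' t := by
  simp [lagrangian, h.deriv_eq, h.self_of_nhds]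

/-- Following `γ` until time `T` and then moving with constant velocity `v`. -/
def appendSegment (γ : ℝ → E) (T : ℝ) (v : E) (t : ℝ) : E := γ (min t T) + max (t - T) 0 • v

lemma lipschitzWith_appendSegment {γ : ℝ → E} (hγ : LipschitzWith 1 γ) (T : ℝ) {v : E}
    (hv : ‖v‖ ≤ 1) : LipschitzWith 1 (appendSegment γ T v) := by
  refine LipschitzWith.of_dist_le_mul fun s t => ?_
  wlog hst : s ≤ t generalizing s t
  · rw [dist_comm, dist_comm s]
    exact this t s (le_of_not_ge hst)
  have h1 : dist (γ (min s T)) (γ (min t T)) ≤ min t T - min s T := by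
    refine (hγ.dist_le_mul _ _).trans ?_
    rw [NNReal.coe_one, one_mul, dist_comm, Real.dist_eq,
      abs_of_nonneg (sub_nonneg.2 (min_le_min_right T hst))]
  have h2 : dist (max (s - T) 0 • v) (max (t - T) 0 • v) ≤ max (t - T) 0 - max (s - T) 0 := by
    have h3 : max (s - T) 0 ≤ max (t - T) 0 := max_le_max_right 0 (by linarith)
    rw [dist_comm, dist_eq_norm, ← sub_smul, norm_smul, Real.norm_eq_abs,
      abs_of_nonneg (sub_nonneg.2 h3)]
    exact mul_le_of_le_one_right (sub_nonneg.2 h3) hv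
  have h3 : ∀ r : ℝ, min r T + max (r - T) 0 = r := fun r => by
    rcases le_total r T with h | h <;> simp [h]
  calc dist (appendSegment γ T v s) (appendSegment γ T v t)
      ≤ (min t T - min s T) + (max (t - T) 0 - max (s - T) 0) :=
        (dist_add_add_le _ _ _ _).trans (add_le_add h1 h2)
    _ = t - s := by linarith [h3 s, h3 t]
    _ = (1 : ℝ≥0) * dist s t := by
        rw [NNReal.coe_one, one_mul, dist_comm, Real.dist_eq, abs_of_nonneg (sub_nonneg.2 hst)]

variable [FiniteDimensional ℝ E]

lemma intervalIntegrable_lagrangian {Φ : E → E} {f : E → ℝ} (hΦ : Continuous Φ)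
    (hf : Continuous f) {γ : ℝ → E} (hγ : LipschitzWith 1 γ) (a b : ℝ) :
    IntervalIntegrable (lagrangian Φ f γ) volume a b :=
  (hγ.intervalIntegrable_inner_deriv (Ψ := fun t => Φ (γ t)) (hΦ.comp hγ.continuous) a b).add
    ((hf.comp hγ.continuous).intervalIntegrable a b)

lemma integral_lagrangian_appendSegment {Φ : E → E} {f : E → ℝ} (hΦ : Continuous Φ)
    (hf : Continuous f) {γ : ℝ → E} (hγ : LipschitzWith 1 γ) {T s : ℝ} (hT : 0 ≤ T) (hs : 0 ≤ s)
    {v : E} (hv : ‖v‖ ≤ 1) :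
    ∫ t in (0:ℝ)..(T + s), lagrangian Φ f (appendSegment γ T v) t =
      (∫ t in (0:ℝ)..T, lagrangian Φ f γ t) +
        ∫ r in (0:ℝ)..s, (⟪Φ (γ T + r • v), v⟫ + f (γ T + r • v)) := by
  have hL := lipschitzWith_appendSegment hγ T hv
  rw [← intervalIntegral.integral_add_adjacent_intervals
    (intervalIntegrable_lagrangian hΦ hf hL 0 T) (intervalIntegrable_lagrangian hΦ hf hL T (T + s))]
  congr 1
  · rw [intervalIntegral.integral_of_le hT, intervalIntegral.integral_of_le hT,
      integral_Ioc_eq_integral_Ioo, integral_Ioc_eq_integral_Ioo]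
    refine setIntegral_congr_fun measurableSet_Ioo fun t ht => lagrangian_congr ?_ Φ f
    filter_upwards [Iio_mem_nhds ht.2] with r hr
    simp [appendSegment, min_eq_left (Set.mem_Iio.1 hr).le, max_eq_right (sub_nonpos.2 (Set.mem_Iio.1 hr).le)]
  · have h : ∫ t in T..(T + s), lagrangian Φ f (appendSegment γ T v) t =
        ∫ r in (0:ℝ)..s, lagrangian Φ f (appendSegment γ T v) (r + T) := by
      rw [intervalIntegral.integral_comp_add_right (lagrangian Φ f (appendSegment γ T v)),
        zero_add, add_comm s]
    rw [h, intervalIntegral.integral_of_le hs, intervalIntegral.integral_of_le hs,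
      integral_Ioc_eq_integral_Ioo, integral_Ioc_eq_integral_Ioo]
    refine setIntegral_congr_fun measurableSet_Ioo fun r hr => ?_
    have heq : (fun q => appendSegment γ T v (q + T)) =ᶠ[nhds r] fun q => γ T + q • v := by
      filter_upwards [Ioi_mem_nhds hr.1] with q hq
      simp [appendSegment, (Set.mem_Ioi.1 hq).le]
    have hd : deriv (fun q : ℝ => γ T + q • v) r = v := by
      simpa using (((hasDerivAt_id r).smul_const v).const_add (γ T)).deriv
    simp only [← lagrangian_comp_add_const, lagrangian_congr heq]
    simp only [lagrangian, hd]

lemma neg_le_integral_lagrangian {Φ : E → E} {f : E → ℝ} (hΦ : Continuous Φ)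
    (hf : Continuous f) {C : ℝ} (hC : ∀ x, ‖Φ x‖ + |f x| ≤ C)
    (H : ∀ γ : ℝ → E, LipschitzWith 1 γ → 0 ≤ ∫ t in (0:ℝ)..1, lagrangian Φ f γ t)
    {γ : ℝ → E} (hγ : LipschitzWith 1 γ) {T : ℝ} (hT : 0 ≤ T) :
    -C ≤ ∫ t in (0:ℝ)..T, lagrangian Φ f γ t := by
  have h_int := intervalIntegrable_lagrangian hΦ hf hγ
  have hn : ∀ n : ℕ, 0 ≤ ∫ t in (0:ℝ)..n, lagrangian Φ f γ t := by
    intro n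
    induction n with
    | zero => simp
    | succ n ih =>
      rw [← intervalIntegral.integral_add_adjacent_intervals (h_int 0 n) (h_int n (n + 1 : ℕ))]
      refine add_nonneg ih ?_
      have h1 : LipschitzWith 1 fun s => γ (s + n) := by
        refine LipschitzWith.of_dist_le_mul fun s t => ?_
        simpa using hγ.dist_le_mul (s + n) (t + n)
      have h2 := H _ h1
      simp only [lagrangian_comp_add_const] at h2
      rw [intervalIntegral.integral_comp_add_right (lagrangian Φ f γ)] at h2
      simpa [add_comm] using h2
  rw [← intervalIntegral.integral_add_adjacent_intervals (h_int 0 ⌊T⌋₊) (h_int ⌊T⌋₊ T)]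
  have hC0 : 0 ≤ C := (add_nonneg (norm_nonneg _) (abs_nonneg _)).trans (hC 0)
  have h3 : |∫ t in (⌊T⌋₊ : ℝ)..T, lagrangian Φ f γ t| ≤ C := by
    rw [← Real.norm_eq_abs]
    refine (intervalIntegral.norm_integral_le_of_norm_le_const
      fun t _ => abs_lagrangian_le hC hγ t).trans (mul_le_of_le_one_right hC0 ?_)
    rw [abs_of_nonneg (sub_nonneg.2 (Nat.floor_le hT))]
    linarith [Nat.lt_floor_add_one T]
  linarith [hn ⌊T⌋₊, (abs_le.1 h3).1]

/-- The value function of a problem with nonnegative action on curves of unit duration is a bounded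
subsolution of the Hamilton-Jacobi equation, in integrated form. -/
lemma exists_bounded_subsolution {Φ : E → E} {f : E → ℝ} (hΦ : Continuous Φ)
    (hf : Continuous f) {C : ℝ} (hC : ∀ x, ‖Φ x‖ + |f x| ≤ C)
    (H : ∀ γ : ℝ → E, LipschitzWith 1 γ → 0 ≤ ∫ t in (0:ℝ)..1, lagrangian Φ f γ t) :
    ∃ u : E → ℝ, (∀ x, |u x| ≤ C) ∧ ∀ (x v : E) (s : ℝ), ‖v‖ ≤ 1 → 0 ≤ s →
      u (x + s • v) ≤ u x + ∫ r in (0:ℝ)..s, (⟪Φ (x + r • v), v⟫ + f (x + r • v)) := by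
  let V : E → Set ℝ := fun x => {a | ∃ T : ℝ, 0 ≤ T ∧ ∃ γ : ℝ → E, LipschitzWith 1 γ ∧ γ T = x ∧
    ∫ t in (0:ℝ)..T, lagrangian Φ f γ t = a}
  have hV0 : ∀ x, (0:ℝ) ∈ V x := fun x =>
    ⟨0, le_rfl, fun _ => x, LipschitzWith.const' x, rfl, by simp⟩
  have hVC : ∀ x, ∀ a ∈ V x, -C ≤ a := by
    rintro x _ ⟨T, hT, γ, hγ, -, rfl⟩
    exact neg_le_integral_lagrangian hΦ hf hC H hγ hT
  have hbdd : ∀ x, BddBelow (V x) := fun x => ⟨-C, hVC x⟩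
  have hC0 : 0 ≤ C := (add_nonneg (norm_nonneg _) (abs_nonneg _)).trans (hC 0)
  refine ⟨fun x => sInf (V x), fun x => abs_le.2
    ⟨le_csInf ⟨0, hV0 x⟩ (hVC x), (csInf_le (hbdd x) (hV0 x)).trans hC0⟩, ?_⟩
  intro x v s hv hs
  rw [← sub_le_iff_le_add]
  refine le_csInf ⟨0, hV0 x⟩ ?_
  rintro _ ⟨T, hT, γ, hγ, rfl, rfl⟩
  rw [sub_le_iff_le_add]
  refine csInf_le (hbdd _) ⟨T + s, add_nonneg hT hs, appendSegment γ T v,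
    lipschitzWith_appendSegment hγ T hv, ?_,
    integral_lagrangian_appendSegment hΦ hf hγ hT hs hv⟩
  simp [appendSegment, hs]

/-- Mollifying a bounded subsolution in integrated form gives a smooth approximate subsolution. -/
lemma exists_contDiff_subsolution [MeasurableSpace E] [BorelSpace E] {Φ : E → E} {f : E → ℝ}
    (hΦ : Continuous Φ) (hΦc : HasCompactSupport Φ) (hf : Continuous f) (hfc : HasCompactSupport f)
    {C : ℝ} (hC : ∀ x, ‖Φ x‖ + |f x| ≤ C) {u : E → ℝ} (hu : ∀ x, |u x| ≤ C)
    (hsub : ∀ (x v : E) (s : ℝ), ‖v‖ ≤ 1 → 0 ≤ s →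
      u (x + s • v) ≤ u x + ∫ r in (0:ℝ)..s, (⟪Φ (x + r • v), v⟫ + f (x + r • v)))
    {δ : ℝ} (hδ : 0 < δ) :
    ∃ w : E → ℝ, ContDiff ℝ (⊤ : ℕ∞) w ∧ (∀ x, |w x| ≤ C) ∧
      ∀ x v, ‖v‖ ≤ 1 → fderiv ℝ w x v ≤ ⟪Φ x, v⟫ + f x + δ := by
  have hC0 : 0 ≤ C := (add_nonneg (norm_nonneg _) (abs_nonneg _)).trans (hC 0)
  have hbd : ∀ y v : E, ‖v‖ ≤ 1 → |⟪Φ y, v⟫ + f y| ≤ C := fun y v hv =>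
    (abs_add_le _ _).trans ((add_le_add_left ((abs_real_inner_le_norm _ _).trans
      (mul_le_of_le_one_right (norm_nonneg _) hv)) _).trans (hC y))
  have hcont : ∀ x v : E, Continuous fun r : ℝ => ⟪Φ (x + r • v), v⟫ + f (x + r • v) := by
    intro x v; fun_prop
  have huL : LipschitzWith ⟨C, hC0⟩ u := by
    refine LipschitzWith.of_le_add_mul _ fun x y => ?_
    rcases eq_or_ne x y with rfl | hxy
    · simp
    have hd : 0 < ‖x - y‖ := norm_pos_iff.2 (sub_ne_zero.2 hxy)
    have h1 := hsub y (‖x - y‖⁻¹ • (x - y)) ‖x - y‖ (by simp [norm_smul, hd.ne']) hd.le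
    rw [smul_inv_smul₀ hd.ne', add_sub_cancel] at h1
    refine h1.trans (add_le_add_right ((le_abs_self _).trans ?_) _)
    rw [← Real.norm_eq_abs]
    refine (intervalIntegral.norm_integral_le_of_norm_le_const
      fun t _ => hbd _ _ (by simp [norm_smul, hd.ne'])).trans_eq ?_
    rw [sub_zero, abs_of_pos hd, dist_eq_norm]
    rfl
  have huc := huL.continuous
  obtain ⟨ε₁, hε₁, hΦε⟩ := Metric.uniformContinuous_iff.1
    (hΦc.uniformContinuous_of_continuous hΦ) (δ / 2) (half_pos hδ)
  obtain ⟨ε₂, hε₂, hfε⟩ := Metric.uniformContinuous_iff.1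
    (hfc.uniformContinuous_of_continuous hf) (δ / 2) (half_pos hδ)
  obtain ⟨ε, hε, hε1, hε2⟩ : ∃ ε > 0, 2 * ε < ε₁ ∧ 2 * ε < ε₂ := by
    refine ⟨min ε₁ ε₂ / 3, by positivity, ?_, ?_⟩
    · linarith [min_le_left ε₁ ε₂]
    · linarith [min_le_right ε₁ ε₂]
  have hclose : ∀ x y v : E, ‖v‖ ≤ 1 → dist y x ≤ 2 * ε →
      ⟪Φ y, v⟫ + f y ≤ ⟪Φ x, v⟫ + f x + δ := by
    intro x y v hv hyx
    have h1 : ⟪Φ y - Φ x, v⟫ ≤ δ / 2 := by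
      refine (real_inner_le_norm _ _).trans ((mul_le_of_le_one_right (norm_nonneg _) hv).trans ?_)
      rw [← dist_eq_norm]
      exact (hΦε (hyx.trans_lt hε1)).le
    have h2 : f y - f x ≤ δ / 2 := (le_abs_self _).trans (hfε (hyx.trans_lt hε2)).le
    rw [inner_sub_left] at h1
    linarith
  let φ : ContDiffBump (0 : E) := ⟨ε / 2, ε, half_pos hε, half_lt_self hε⟩
  let k : E → ℝ := φ.normed volume
  have hk0 : ∀ t, 0 ≤ k t := φ.nonneg_normed
  have hk1 : ∫ t, k t = 1 := φ.integral_normed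
  have hkcont : Continuous k := φ.continuous_normed
  have hkc : HasCompactSupport k := φ.hasCompactSupport_normed
  have hkint : Integrable k := hkcont.integrable_of_hasCompactSupport hkc
  have h_int : ∀ x, Integrable fun t => k t * u (x - t) := fun x =>
    (hkcont.mul (huc.comp (continuous_const.sub continuous_id))).integrable_of_hasCompactSupport
      hkc.mul_right
  let w : E → ℝ := convolution k u (ContinuousLinearMap.lsmul ℝ ℝ) volume
  have hw : ∀ x, w x = ∫ t, k t * u (x - t) := fun x => rfl
  have hwsm : ContDiff ℝ (⊤ : ℕ∞) w :=
    hkc.contDiff_convolution_left _ φ.contDiff_normed huc.locallyIntegrable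
  refine ⟨w, hwsm, fun x => ?_, fun x v hv => ?_⟩
  · rw [hw, ← Real.norm_eq_abs]
    calc _ ≤ ∫ t, k t * C := norm_integral_le_of_norm_le (hkint.mul_const C)
          (ae_of_all _ fun t => by
            rw [norm_mul, Real.norm_of_nonneg (hk0 t)]
            exact mul_le_mul_of_nonneg_left (hu _) (hk0 t))
      _ = C := by rw [integral_mul_const, hk1, one_mul]
  · have hincr : ∀ s : ℝ, 0 < s → s ≤ ε → w (x + s • v) - w x ≤ s * (⟪Φ x, v⟫ + f x + δ) := by
      intro s hs hsε
      rw [hw, hw, ← integral_sub (h_int _) (h_int _)]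
      calc _ ≤ ∫ t, k t * (s * (⟪Φ x, v⟫ + f x + δ)) := by
            refine integral_mono ((h_int _).sub (h_int _)) (hkint.mul_const _) fun t => ?_
            simp only
            rw [← mul_sub]
            by_cases ht : k t = 0
            · simp [ht]
            have ht' : ‖t‖ < ε := by
              have : t ∈ Function.support k := ht
              rw [show Function.support k = Metric.ball 0 ε from φ.support_normed_eq] at this
              simpa using this
            refine mul_le_mul_of_nonneg_left ?_ (hk0 t)
            have h1 := hsub (x - t) v s hv hs.le
            have h2 : ∫ r in (0:ℝ)..s, (⟪Φ (x - t + r • v), v⟫ + f (x - t + r • v)) ≤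
                ∫ r in (0:ℝ)..s, (⟪Φ x, v⟫ + f x + δ) := by
              refine intervalIntegral.integral_mono_on hs.le
                ((hcont _ _).intervalIntegrable _ _) (by simp) fun r hr => hclose _ _ _ hv ?_
              rw [dist_eq_norm, show x - t + r • v - x = r • v - t by abel]
              refine (norm_sub_le _ _).trans ?_
              have : ‖r • v‖ ≤ ε := by
                rw [norm_smul, Real.norm_of_nonneg hr.1]
                exact (mul_le_of_le_one_right hr.1 hv).trans (hr.2.trans hsε)
              linarith
            rw [intervalIntegral.integral_const, sub_zero, smul_eq_mul] at h2
            rw [show x + s • v - t = x - t + s • v by abel]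
            linarith
        _ = _ := by rw [integral_mul_const, hk1, one_mul]
    have hder : HasDerivAt (fun s : ℝ => w (x + s • v)) (fderiv ℝ w x v) 0 := by
      have h1 : HasFDerivAt w (fderiv ℝ w x) (x + (0:ℝ) • v) := by
        simpa using (hwsm.differentiable (by simp) x).hasFDerivAt
      have h2 : HasDerivAt (fun s : ℝ => x + s • v) v 0 := by
        simpa using ((hasDerivAt_id (0:ℝ)).smul_const v).const_add x
      exact h1.comp_hasDerivAt 0 h2
    refine le_of_tendsto hder.tendsto_slope_zero_right ?_
    filter_upwards [Ioc_mem_nhdsGT hε] with s hs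
    have := hincr s hs.1 hs.2
    simp only [zero_add, zero_smul, add_zero, smul_eq_mul]
    rwa [inv_mul_le_iff₀ hs.1]

end Duality

section DivergenceFree

variable {E : Type*} [NormedAddCommGroup E] [InnerProductSpace ℝ E] [FiniteDimensional ℝ E]
  [MeasurableSpace E] [BorelSpace E]

/-- If the action of `Φ + f` is nonnegative on all `1`-Lipschitz curves of unit duration, then its
integral against a divergence-free measure in polar form is nonnegative. -/
lemma integral_nonneg_of_action_nonneg {ρ : Measure E} [IsFiniteMeasure ρ] {τ : E → E}
    (hτm : Measurable τ) (hτ1 : ∀ᵐ x ∂ρ, ‖τ x‖ = 1)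
    (hdiv : ∀ φ : E → ℝ, ContDiff ℝ (⊤ : ℕ∞) φ → HasCompactSupport φ →
      ∫ x, fderiv ℝ φ x (τ x) ∂ρ = 0)
    {Φ : E → E} {f : E → ℝ} (hΦ : Continuous Φ) (hΦc : HasCompactSupport Φ)
    (hf : Continuous f) (hfc : HasCompactSupport f)
    (H : ∀ γ : ℝ → E, LipschitzWith 1 γ → 0 ≤ ∫ t in (0:ℝ)..1, lagrangian Φ f γ t) :
    0 ≤ ∫ x, (⟪Φ x, τ x⟫ + f x) ∂ρ := by
  obtain ⟨C₁, hC₁⟩ := hΦc.exists_bound_of_continuous hΦ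
  obtain ⟨C₂, hC₂⟩ := hfc.exists_bound_of_continuous hf
  set C := C₁ + C₂
  have hC : ∀ x, ‖Φ x‖ + |f x| ≤ C := fun x => add_le_add (hC₁ x) (hC₂ x)
  have hC0 : 0 ≤ C := (add_nonneg (norm_nonneg _) (abs_nonneg _)).trans (hC 0)
  obtain ⟨u, hu, hsub⟩ := exists_bounded_subsolution hΦ hf hC H
  let χ : ContDiffBump (0 : E) := ⟨1, 2, one_pos, one_lt_two⟩
  have hχc : HasCompactSupport χ := χ.hasCompactSupport
  have hχs : ContDiff ℝ (⊤ : ℕ∞) χ := χ.contDiff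
  obtain ⟨D, hD⟩ := (hχc.fderiv ℝ).exists_bound_of_continuous (hχs.continuous_fderiv (by simp))
  have hD0 : 0 ≤ D := (norm_nonneg _).trans (hD 0)
  obtain ⟨R₀, hR₀⟩ := (hΦc.isCompact.isBounded.union hfc.isCompact.isBounded).subset_closedBall 0
  have hintL : Integrable (fun x => ⟪Φ x, τ x⟫ + f x) ρ := by
    refine Integrable.of_bound (C := C)
      ((hΦ.measurable.inner hτm).add hf.measurable).aestronglyMeasurable ?_
    filter_upwards [hτ1] with x hx
    refine (norm_add_le _ _).trans (le_trans (add_le_add_left (norm_inner_le_norm _ _) _) ?_)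
    rw [hx, mul_one]
    exact hC x
  set M := ρ.real Set.univ
  have hM0 : 0 ≤ M := measureReal_nonneg
  have key : ∀ δ > 0, ∀ R : ℝ, 0 < R → R₀ ≤ R →
      0 ≤ (∫ x, (⟪Φ x, τ x⟫ + f x) ∂ρ) + (δ + C * (R⁻¹ * D)) * M := by
    intro δ hδ R hR hRR
    obtain ⟨w, hws, hwC, hw⟩ := exists_contDiff_subsolution hΦ hΦc hf hfc hC hu hsub hδ
    let c : E → ℝ := fun x => χ (R⁻¹ • x)
    have hcs : ContDiff ℝ (⊤ : ℕ∞) c := hχs.comp (contDiff_const_smul _)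
    have hcc : HasCompactSupport c := hχc.comp_smul (inv_ne_zero hR.ne')
    have hc' : ∀ x v, fderiv ℝ c x v = R⁻¹ * fderiv ℝ χ (R⁻¹ • x) v := by
      intro x v
      have h1 : HasFDerivAt c _ x :=
        ((hχs.differentiable (by simp) (R⁻¹ • x)).hasFDerivAt).comp x
          ((hasFDerivAt_id x).const_smul R⁻¹)
      rw [h1.fderiv]
      simp
    have hdivw := hdiv (fun x => c x * w x) (hcs.mul hws) hcc.mul_right
    have hc1 : ∀ x, 0 ≤ c x ∧ c x ≤ 1 := fun x => ⟨χ.nonneg, χ.le_one⟩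
    have hcL : ∀ x, c x * (⟪Φ x, τ x⟫ + f x) = ⟪Φ x, τ x⟫ + f x := by
      intro x
      by_cases hx : x ∈ Metric.closedBall (0 : E) R
      · have : c x = 1 := by
          refine χ.one_of_mem_closedBall ?_
          have hx' : ‖x‖ ≤ R := by simpa using hx
          simp only [Metric.mem_closedBall, dist_zero_right, norm_smul, norm_inv,
            Real.norm_of_nonneg hR.le]
          rw [inv_mul_le_iff₀ hR]
          exact hx'.trans_eq (mul_one R).symm
        rw [this, one_mul]
      · have h0 : x ∉ tsupport Φ ∪ tsupport f := fun h =>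
          hx (Metric.closedBall_subset_closedBall hRR (hR₀ h))
        rw [image_eq_zero_of_notMem_tsupport fun h => h0 (Or.inl h),
          image_eq_zero_of_notMem_tsupport fun h => h0 (Or.inr h)]
        simp
    have hle : ∀ᵐ x ∂ρ, fderiv ℝ (fun x => c x * w x) x (τ x) ≤
        (⟪Φ x, τ x⟫ + f x) + (δ + C * (R⁻¹ * D)) := by
      filter_upwards [hτ1] with x hx
      rw [fderiv_fun_mul (hcs.differentiable (by simp) x) (hws.differentiable (by simp) x)]
      simp only [add_apply, smul_apply, smul_eq_mul]
      have h1 : c x * fderiv ℝ w x (τ x) ≤ (⟪Φ x, τ x⟫ + f x) + δ := by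
        refine (mul_le_mul_of_nonneg_left (hw x (τ x) hx.le) (hc1 x).1).trans ?_
        rw [mul_add, hcL]
        exact add_le_add_right (mul_le_of_le_one_left hδ.le (hc1 x).2) _
      have h2 : w x * fderiv ℝ c x (τ x) ≤ C * (R⁻¹ * D) := by
        refine (le_abs_self _).trans ?_
        rw [abs_mul, hc', abs_mul, abs_of_pos (inv_pos.2 hR)]
        have h3 : |fderiv ℝ χ (R⁻¹ • x) (τ x)| ≤ D := by
          refine ((fderiv ℝ χ (R⁻¹ • x)).le_opNorm (τ x)).trans ?_
          rw [hx, mul_one]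
          exact hD _
        gcongr
        exact hwC x
      linarith
    have hintw : Integrable (fun x => fderiv ℝ (fun x => c x * w x) x (τ x)) ρ := by
      have hs : ContDiff ℝ (⊤ : ℕ∞) fun x => c x * w x := hcs.mul hws
      have hcp : HasCompactSupport fun x => c x * w x := hcc.mul_right
      obtain ⟨B, hB⟩ := (hcp.fderiv ℝ).exists_bound_of_continuous (hs.continuous_fderiv (by simp))
      refine Integrable.of_bound (C := B) ?_ ?_
      · exact ((isBoundedBilinearMap_apply.continuous.measurable).comp
          ((hs.continuous_fderiv (by simp)).measurable.prodMk hτm)).aestronglyMeasurable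
      · filter_upwards [hτ1] with x hx
        refine (ContinuousLinearMap.le_opNorm _ _).trans ?_
        rw [hx, mul_one]
        exact hB x
    have := integral_mono_ae hintw (hintL.add (integrable_const _)) hle
    rw [hdivw] at this
    refine this.trans_eq ?_
    simp only [Pi.add_apply]
    rw [integral_add hintL (integrable_const _), integral_const, smul_eq_mul, mul_comm]
  have hlim : Filter.Tendsto
      (fun n : ℕ => (∫ x, (⟪Φ x, τ x⟫ + f x) ∂ρ) +
        (((n : ℝ) + 1)⁻¹ + C * (((n : ℝ) + 1)⁻¹ * D)) * M) atTop
      (nhds ((∫ x, (⟪Φ x, τ x⟫ + f x) ∂ρ) + (0 + C * (0 * D)) * M)) := by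
    have h0 : Filter.Tendsto (fun n : ℕ => ((n : ℝ) + 1)⁻¹) atTop (nhds 0) := by
      simpa [one_div] using tendsto_one_div_add_atTop_nhds_zero_nat (𝕜 := ℝ)
    exact ((h0.add ((h0.mul_const D).const_mul C)).mul_const M).const_add _
  rw [zero_mul, mul_zero, add_zero, zero_mul, add_zero] at hlim
  refine ge_of_tendsto hlim ?_
  filter_upwards [tendsto_natCast_atTop_atTop.eventually_ge_atTop R₀] with n hn
  exact key _ (by positivity) ((n : ℝ) + 1) (by positivity) (by linarith)

end DivergenceFree

section Extension

open CompactlySupported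

variable {X : Type*} [TopologicalSpace X] [T2Space X] [LocallyCompactSpace X] [MeasurableSpace X]
  [BorelSpace X] {W : Type*} [AddCommGroup W] [Module ℝ W]

/-- A linear functional on the parameter space of a family of compactly supported functions, that
is nonnegative whenever the corresponding function is, is represented by a measure. -/
lemma exists_measure_integral_eq (L : W →ₗ[ℝ] C_c(X, ℝ)) (l : W →ₗ[ℝ] ℝ)
    (hpos : ∀ w, (∀ x, 0 ≤ L w x) → 0 ≤ l w) (hdom : ∀ g : C_c(X, ℝ), ∃ w, ∀ x, g x ≤ L w x) :
    ∃ η : Measure X, η.Regular ∧ ∀ w, ∫ x, L w x ∂η = l w := by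
  let s : PointedCone ℝ (W × C_c(X, ℝ)) :=
    { carrier := {p | ∀ x, 0 ≤ L p.1 x + p.2 x}
      add_mem' := fun {p q} hp hq x => by
        have := add_nonneg (hp x) (hq x)
        simp only [Prod.fst_add, Prod.snd_add, map_add, CompactlySupportedContinuousMap.add_apply]
        linarith
      zero_mem' := fun x => by simp
      smul_mem' := fun c p hp x => by
        have h1 : L (c • p).1 x + (c • p).2 x = (c : ℝ) * (L p.1 x + p.2 x) := by
          change L ((c : ℝ) • p.1) x + ((c : ℝ) • p.2) x = _
          rw [map_smul]
          simp only [CompactlySupportedContinuousMap.smul_apply, smul_eq_mul, mul_add]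
        rw [h1]
        exact mul_nonneg c.2 (hp x) }
  let D : Submodule ℝ (W × C_c(X, ℝ)) := Submodule.prod ⊤ ⊥
  let F : (W × C_c(X, ℝ)) →ₗ.[ℝ] ℝ := ⟨D, l ∘ₗ LinearMap.fst ℝ W C_c(X, ℝ) ∘ₗ D.subtype⟩
  have hF : ∀ w, ((w, 0) : W × C_c(X, ℝ)) ∈ D := fun w => by simp [D]
  obtain ⟨G, hGF, hGs⟩ := riesz_extension s F
    (by
      rintro ⟨⟨w, g⟩, hw⟩ hs
      obtain rfl : g = 0 := (Submodule.mem_bot ℝ).1 (Submodule.mem_prod.1 hw).2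
      exact hpos w fun x => by simpa using hs x)
    (by
      rintro ⟨w, g⟩
      obtain ⟨w', hw'⟩ := hdom (-g)
      refine ⟨⟨(w' - w, 0), hF _⟩, fun x => ?_⟩
      have := hw' x
      simp at this ⊢
      linarith)
  have hGl : ∀ w, G (0, L w) = l w := by
    intro w
    have h1 : G (w, 0) = l w := hGF ⟨(w, 0), hF w⟩
    have h2 : 0 ≤ G (w, -L w) := hGs _ fun x => by simp
    have h3 : 0 ≤ G (-w, L w) := hGs _ fun x => by simp
    have h4 : G (w, -L w) = G (w, 0) - G (0, L w) := by rw [← map_sub]; simp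
    have h5 : G (-w, L w) = G (0, L w) - G (w, 0) := by rw [← map_sub]; simp
    linarith
  let Λ : C_c(X, ℝ) →ₚ[ℝ] ℝ := PositiveLinearMap.mk₀ (G ∘ₗ LinearMap.inr ℝ W C_c(X, ℝ))
    fun g hg => hGs _ fun x => by simpa using hg x
  exact ⟨RealRMK.rieszMeasure Λ, inferInstance, fun w =>
    (RealRMK.integral_rieszMeasure Λ (L w)).trans (hGl w)⟩

end Extension

namespace UnitSpeedCurve

open CompactlySupported

variable {E : Type*} [NormedAddCommGroup E]

instance : MeasurableSpace (UnitSpeedCurve E) := borel _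

instance : BorelSpace (UnitSpeedCurve E) := ⟨rfl⟩

variable [InnerProductSpace ℝ E] [FiniteDimensional ℝ E]

lemma action_eq_integral_lagrangian {Φ : E → E} {f : E → ℝ} (hΦ : Continuous Φ)
    (hf : Continuous f) (γ : UnitSpeedCurve E) :
    action Φ f γ = ∫ t in (0:ℝ)..1, lagrangian Φ f γ.extend t :=
  (intervalIntegral.integral_add (γ.lipschitzWith_extend.intervalIntegrable_inner_deriv
    (Ψ := fun t => Φ (γ.extend t)) (hΦ.comp γ.lipschitzWith_extend.continuous) 0 1)
    ((hf.comp γ.lipschitzWith_extend.continuous).intervalIntegrable 0 1)).symm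

/-- The action as a linear map of the vector field and the potential. -/
def actionₗ : C_c(E, E) × C_c(E, ℝ) →ₗ[ℝ] C_c(UnitSpeedCurve E, ℝ) where
  toFun p := ⟨⟨action p.1 p.2, continuous_action p.1.continuous p.1.hasCompactSupport
    p.2.continuous⟩, hasCompactSupport_action p.1.hasCompactSupport p.2.hasCompactSupport⟩
  map_add' p q := by
    ext γ
    change action _ _ γ = action _ _ γ + action _ _ γ
    have hγ := γ.lipschitzWith_extend
    rw [action_eq_integral_lagrangian (map_continuous (p + q).1) (map_continuous (p + q).2),
      action_eq_integral_lagrangian (map_continuous p.1) (map_continuous p.2),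
      action_eq_integral_lagrangian (map_continuous q.1) (map_continuous q.2),
      ← intervalIntegral.integral_add
        (intervalIntegrable_lagrangian (map_continuous p.1) (map_continuous p.2) hγ 0 1)
        (intervalIntegrable_lagrangian (map_continuous q.1) (map_continuous q.2) hγ 0 1)]
    refine intervalIntegral.integral_congr fun t _ => ?_
    simp only [lagrangian, Prod.fst_add, Prod.snd_add, CompactlySupportedContinuousMap.add_apply,
      inner_add_left]
    ring
  map_smul' c p := by
    ext γ
    change action _ _ γ = c * action _ _ γ
    rw [action_eq_integral_lagrangian (map_continuous (c • p).1) (map_continuous (c • p).2),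
      action_eq_integral_lagrangian (map_continuous p.1) (map_continuous p.2),
      ← intervalIntegral.integral_const_mul]
    refine intervalIntegral.integral_congr fun t _ => ?_
    simp only [lagrangian, Prod.smul_fst, Prod.smul_snd,
      CompactlySupportedContinuousMap.smul_apply, inner_smul_left, smul_eq_mul]
    simp
    ring

lemma exists_action_ge (g : C_c(UnitSpeedCurve E, ℝ)) :
    ∃ f : C_c(E, ℝ), ∀ γ, g γ ≤ action (0 : E → E) f γ := by
  obtain ⟨C, hC⟩ := g.hasCompactSupport.exists_bound_of_continuous g.continuous
  have hC0 : 0 ≤ C := (norm_nonneg _).trans (hC ⟨0, LipschitzWith.const' 0⟩)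
  obtain ⟨R, hR⟩ := (g.hasCompactSupport.isCompact.image
    (continuous_extend_apply (E := E) 0)).isBounded.exists_norm_le
  obtain ⟨R, hR1, hR0⟩ : ∃ R' : ℝ, (∀ y ∈ (fun γ : UnitSpeedCurve E => γ.extend 0) '' tsupport g,
      ‖y‖ ≤ R') ∧ 0 ≤ R' := ⟨max R 0, fun y hy => (hR y hy).trans (le_max_left _ _), le_max_right _ _⟩
  let χ : ContDiffBump (0 : E) := ⟨R + 1, R + 2, by linarith, by linarith⟩
  let f : C_c(E, ℝ) := C • ⟨⟨χ, χ.continuous⟩, χ.hasCompactSupport⟩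
  have hf : ∀ x, f x = C * χ x := fun x => rfl
  refine ⟨f, fun γ => ?_⟩
  have hact : action (0 : E → E) f γ = ∫ t in (0:ℝ)..1, f (γ.extend t) := by simp [action]
  rw [hact]
  have hnn : 0 ≤ ∫ t in (0:ℝ)..1, f (γ.extend t) :=
    intervalIntegral.integral_nonneg zero_le_one fun t _ => mul_nonneg hC0 χ.nonneg
  by_cases hγ : γ ∈ tsupport g
  · refine ((le_abs_self _).trans (hC γ)).trans_eq ?_
    rw [intervalIntegral.integral_congr (g := fun _ => C)]
    · simp
    · intro t ht
      rw [Set.uIcc_of_le zero_le_one] at ht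
      have h1 := hR1 _ ⟨γ, hγ, rfl⟩
      have h2 := γ.dist_extend_zero_le ht
      have h3 : γ.extend t ∈ Metric.closedBall (0 : E) χ.rIn := by
        rw [Metric.mem_closedBall]
        refine (dist_triangle _ (γ.extend 0) _).trans ?_
        rw [dist_zero_right]
        change _ ≤ R + 1
        linarith
      simp only [hf, χ.one_of_mem_closedBall h3, mul_one]
  · rwa [image_eq_zero_of_notMem_tsupport hγ]

/-- A divergence-free vector measure is a superposition of `1`-Lipschitz curves of unit duration,
in such a way that its total variation is the superposition of the occupation measures. -/
lemma exists_superposition [MeasurableSpace E] [BorelSpace E] {ρ : Measure E} [IsFiniteMeasure ρ]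
    {τ : E → E} (hτm : Measurable τ) (hτ1 : ∀ᵐ x ∂ρ, ‖τ x‖ = 1)
    (hdiv : ∀ φ : E → ℝ, ContDiff ℝ (⊤ : ℕ∞) φ → HasCompactSupport φ →
      ∫ x, fderiv ℝ φ x (τ x) ∂ρ = 0) :
    ∃ η : Measure (UnitSpeedCurve E), η.Regular ∧ ∀ (Φ : E → E) (f : E → ℝ), Continuous Φ →
      HasCompactSupport Φ → Continuous f → HasCompactSupport f →
      ∫ γ, action Φ f γ ∂η = ∫ x, (⟪Φ x, τ x⟫ + f x) ∂ρ := by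
  have h_int : ∀ p : C_c(E, E) × C_c(E, ℝ), Integrable (fun x => ⟪p.1 x, τ x⟫ + p.2 x) ρ := by
    intro p
    obtain ⟨C, hC⟩ := p.1.hasCompactSupport.exists_bound_of_continuous p.1.continuous
    refine Integrable.add (Integrable.of_bound (C := C)
      (p.1.continuous.measurable.inner hτm).aestronglyMeasurable ?_)
      (p.2.continuous.integrable_of_hasCompactSupport p.2.hasCompactSupport)
    filter_upwards [hτ1] with x hx
    refine (norm_inner_le_norm _ _).trans ?_
    rw [hx, mul_one]
    exact hC x
  let l : C_c(E, E) × C_c(E, ℝ) →ₗ[ℝ] ℝ :=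
    { toFun := fun p => ∫ x, (⟪p.1 x, τ x⟫ + p.2 x) ∂ρ
      map_add' := fun p q => by
        rw [← integral_add (h_int p) (h_int q)]
        refine integral_congr_ae (ae_of_all _ fun x => ?_)
        simp only [Prod.fst_add, Prod.snd_add, CompactlySupportedContinuousMap.add_apply,
          inner_add_left]
        ring
      map_smul' := fun c p => by
        rw [RingHom.id_apply, smul_eq_mul, ← integral_const_mul]
        refine integral_congr_ae (ae_of_all _ fun x => ?_)
        simp only [Prod.smul_fst, Prod.smul_snd, CompactlySupportedContinuousMap.smul_apply,
          inner_smul_left, smul_eq_mul]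
        simp
        ring }
  obtain ⟨η, hη, hηl⟩ := exists_measure_integral_eq actionₗ l
    (fun p hp => integral_nonneg_of_action_nonneg hτm hτ1 hdiv p.1.continuous
      p.1.hasCompactSupport p.2.continuous p.2.hasCompactSupport fun γ hγ => by
        let γ' : UnitSpeedCurve E := ⟨⟨fun t => γ t, hγ.continuous.comp continuous_subtype_val⟩,
          fun s t => hγ s t⟩
        refine (hp γ').trans_eq ((action_eq_integral_lagrangian p.1.continuous p.2.continuous
          γ').trans ?_)
        rw [intervalIntegral.integral_of_le zero_le_one, intervalIntegral.integral_of_le zero_le_one,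
          integral_Ioc_eq_integral_Ioo, integral_Ioc_eq_integral_Ioo]
        refine setIntegral_congr_fun measurableSet_Ioo fun t ht => lagrangian_congr ?_ _ _
        filter_upwards [Ioo_mem_nhds ht.1 ht.2] with r hr
        exact Set.IccExtend_of_mem zero_le_one _ (Set.Ioo_subset_Icc_self hr))
    (fun g => by
      obtain ⟨f, hf⟩ := exists_action_ge g
      exact ⟨(0, f), hf⟩)
  exact ⟨η, hη, fun Φ f hΦ hΦc hf hfc => hηl (⟨⟨Φ, hΦ⟩, hΦc⟩, ⟨⟨f, hf⟩, hfc⟩)⟩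

end UnitSpeedCurve

section Assembly

variable {d : ℕ}

instance : BorelSpace (Curve d) := ⟨rfl⟩

lemma continuous_curveRestrict : Continuous (curveRestrict (d := d)) := continuous_induced_dom

/-- A curve parametrized by the unit interval, as a globally defined Lipschitz curve. -/
def UnitSpeedCurve.toCurve (γ : UnitSpeedCurve (Ed d)) : Curve d :=
  ⟨γ.extend, 1, γ.lipschitzWith_extend⟩

lemma UnitSpeedCurve.curveRestrict_toCurve (γ : UnitSpeedCurve (Ed d)) :
    curveRestrict γ.toCurve = γ.1 := by
  ext1 t
  exact Set.IccExtend_val zero_le_one γ.1 t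

lemma UnitSpeedCurve.continuous_toCurve :
    Continuous (UnitSpeedCurve.toCurve (d := d)) := by
  refine continuous_induced_rng.2 ?_
  simp only [Function.comp_def, UnitSpeedCurve.curveRestrict_toCurve]
  exact continuous_subtype_val

variable (d) in
/-- The curves whose restriction to the unit interval is `1`-Lipschitz. -/
def unitSpeedSet : Set (Curve d) := {γ | LipschitzWith 1 (curveRestrict γ)}

lemma measurableSet_unitSpeedSet : MeasurableSet (unitSpeedSet d) :=
  (UnitSpeedCurve.isClosed_setOf_lipschitzWith.preimage continuous_curveRestrict).measurableSet

/-- The restriction of a `1`-Lipschitz curve to the unit interval. -/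
def toUnitSpeed (γ : unitSpeedSet d) : UnitSpeedCurve (Ed d) := ⟨curveRestrict γ.1, γ.2⟩

lemma continuous_toUnitSpeed : Continuous (toUnitSpeed (d := d)) :=
  (continuous_curveRestrict.comp continuous_subtype_val).subtype_mk _

lemma eqOn_extend_toUnitSpeed (γ : unitSpeedSet d) :
    Set.EqOn γ.1.1 (toUnitSpeed γ).extend (Set.Icc 0 1) := fun _ ht =>
  (Set.IccExtend_of_mem zero_le_one (curveRestrict γ.1) ht).symm

lemma integral_congr_of_eqOn {γ γ' : ℝ → Ed d} (h : Set.EqOn γ γ' (Set.Icc 0 1))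
    (F : Ed d → Ed d → ℝ) :
    ∫ t in (0:ℝ)..1, F (γ t) (deriv γ t) = ∫ t in (0:ℝ)..1, F (γ' t) (deriv γ' t) := by
  rw [intervalIntegral.integral_of_le zero_le_one, intervalIntegral.integral_of_le zero_le_one,
    integral_Ioc_eq_integral_Ioo, integral_Ioc_eq_integral_Ioo]
  refine setIntegral_congr_fun measurableSet_Ioo fun t ht => ?_
  have h1 : γ =ᶠ[nhds t] γ' := by
    filter_upwards [Ioo_mem_nhds ht.1 ht.2] with r hr
    exact h (Set.Ioo_subset_Icc_self hr)
  simp only [h1.deriv_eq, h1.self_of_nhds]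

/-- The pairing of the occupation measure of a curve with a function. -/
def curveOcc (γ : ℝ → Ed d) (f : Ed d → ℝ) : ℝ := ∫ t in (0:ℝ)..1, f (γ t)

lemma UnitSpeedCurve.curveMass_le (γ : UnitSpeedCurve (Ed d)) {f : Ed d → ℝ} (hf : Continuous f)
    (hf0 : ∀ x, 0 ≤ f x) : curveMass γ.extend f ≤ curveOcc γ.extend f ∧
      ∀ Φ : Ed d → Ed d, Continuous Φ →
        curvePair γ.extend Φ ≤ curveMass γ.extend f + curveOcc γ.extend fun x => |‖Φ x‖ - f x| := by
  have hγ := γ.lipschitzWith_extend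
  have hder : ∀ t, ‖deriv γ.extend t‖ ≤ 1 := fun t => by
    simpa using norm_deriv_le_of_lipschitz (x₀ := t) hγ
  have hfγ : Continuous fun t => f (γ.extend t) := hf.comp hγ.continuous
  have hmass : IntervalIntegrable (fun t => f (γ.extend t) * ‖deriv γ.extend t‖) volume 0 1 := by
    refine (hfγ.intervalIntegrable 0 1).mono_fun'
      (hfγ.measurable.mul (measurable_deriv _).norm).aestronglyMeasurable (ae_of_all _ fun t => ?_)
    change ‖f (γ.extend t) * ‖deriv γ.extend t‖‖ ≤ f (γ.extend t)
    rw [norm_mul, norm_norm, Real.norm_of_nonneg (hf0 _)]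
    exact mul_le_of_le_one_right (hf0 _) (hder t)
  refine ⟨intervalIntegral.integral_mono_on zero_le_one hmass (hfγ.intervalIntegrable 0 1)
    fun t _ => mul_le_of_le_one_right (hf0 _) (hder t), fun Φ hΦ => ?_⟩
  have hg : Continuous fun t => |‖Φ (γ.extend t)‖ - f (γ.extend t)| :=
    ((hΦ.comp hγ.continuous).norm.sub hfγ).abs
  rw [curvePair, curveMass, curveOcc,
    ← intervalIntegral.integral_add hmass (hg.intervalIntegrable 0 1)]
  refine intervalIntegral.integral_mono_on zero_le_one (hγ.intervalIntegrable_inner_deriv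
    (Ψ := fun t => Φ (γ.extend t)) (hΦ.comp hγ.continuous) 0 1)
    (hmass.add (hg.intervalIntegrable 0 1)) fun t _ => ?_
  have h1 := real_inner_le_norm (Φ (γ.extend t)) (deriv γ.extend t)
  have h2 : (‖Φ (γ.extend t)‖ - f (γ.extend t)) * ‖deriv γ.extend t‖ ≤
      |‖Φ (γ.extend t)‖ - f (γ.extend t)| :=
    (mul_le_mul_of_nonneg_right (le_abs_self _) (norm_nonneg _)).trans
      (mul_le_of_le_one_right (abs_nonneg _) (hder t))
  linarith

lemma curveMass_le_of_mem {γ : Curve d} (h : γ ∈ unitSpeedSet d) {f : Ed d → ℝ}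
    (hf : Continuous f) (hf0 : ∀ x, 0 ≤ f x) : curveMass γ.1 f ≤ curveOcc γ.1 f ∧
      ∀ Φ : Ed d → Ed d, Continuous Φ →
        curvePair γ.1 Φ ≤ curveMass γ.1 f + curveOcc γ.1 fun x => |‖Φ x‖ - f x| := by
  have he := eqOn_extend_toUnitSpeed ⟨γ, h⟩
  have hp : ∀ Φ, curvePair γ.1 Φ = curvePair (toUnitSpeed ⟨γ, h⟩).extend Φ := fun Φ =>
    integral_congr_of_eqOn he fun x v => ⟪Φ x, v⟫
  have hm : ∀ f, curveMass γ.1 f = curveMass (toUnitSpeed ⟨γ, h⟩).extend f := fun f =>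
    integral_congr_of_eqOn he fun x v => f x * ‖v‖
  have ho : ∀ f, curveOcc γ.1 f = curveOcc (toUnitSpeed ⟨γ, h⟩).extend f := fun f =>
    integral_congr_of_eqOn he fun x _ => f x
  simp only [hp, hm, ho]
  exact UnitSpeedCurve.curveMass_le _ hf hf0

lemma continuousOn_action {Φ : Ed d → Ed d} {f : Ed d → ℝ} (hΦ : Continuous Φ)
    (hΦc : HasCompactSupport Φ) (hf : Continuous f) :
    ContinuousOn (fun γ : Curve d => curvePair γ.1 Φ + curveOcc γ.1 f) (unitSpeedSet d) := by
  rw [continuousOn_iff_continuous_domRestrict]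
  refine ((UnitSpeedCurve.continuous_action hΦ hΦc hf).comp continuous_toUnitSpeed).congr
    fun γ => ?_
  have he := eqOn_extend_toUnitSpeed γ
  exact congrArg₂ (· + ·) (integral_congr_of_eqOn he fun x v => ⟪Φ x, v⟫).symm
    (integral_congr_of_eqOn he fun x _ => f x).symm

lemma exists_curve_superposition {ρ : Measure (Ed d)} [IsFiniteMeasure ρ]
    {τ : Ed d → Ed d} (hτm : Measurable τ) (hτ1 : ∀ᵐ x ∂ρ, ‖τ x‖ = 1)
    (hdiv : ∀ φ : Ed d → ℝ, ContDiff ℝ (⊤ : ℕ∞) φ → HasCompactSupport φ →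
      ∫ x, fderiv ℝ φ x (τ x) ∂ρ = 0) :
    ∃ η : Measure (Curve d), SigmaFinite η ∧ (∀ᵐ γ ∂η, γ ∈ unitSpeedSet d) ∧
      ∀ (Φ : Ed d → Ed d) (f : Ed d → ℝ), Continuous Φ → HasCompactSupport Φ →
        Continuous f → HasCompactSupport f →
        Integrable (fun γ : Curve d => curvePair γ.1 Φ + curveOcc γ.1 f) η ∧
        ∫ γ, (curvePair γ.1 Φ + curveOcc γ.1 f) ∂η = ∫ x, (⟪Φ x, τ x⟫ + f x) ∂ρ := by
  obtain ⟨η, hη, hηint⟩ := UnitSpeedCurve.exists_superposition hτm hτ1 hdiv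
  have hm : Measurable (UnitSpeedCurve.toCurve (d := d)) :=
    UnitSpeedCurve.continuous_toCurve.measurable
  have hmem : ∀ᵐ γ ∂(η.map UnitSpeedCurve.toCurve), γ ∈ unitSpeedSet d := by
    refine (ae_map_iff hm.aemeasurable measurableSet_unitSpeedSet).2 (ae_of_all _ fun γ => ?_)
    rw [γ.curveRestrict_toCurve]
    exact γ.2
  refine ⟨η.map UnitSpeedCurve.toCurve, ⟨⟨⟨fun n => {γ | ‖γ.1 0‖ ≤ n}, fun _ => trivial,
    fun n => ?_, ?_⟩⟩⟩, hmem, fun Φ f hΦ hΦc hf hfc => ?_⟩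
  · have hcl : IsClosed {γ : Curve d | ‖γ.1 0‖ ≤ n} :=
      isClosed_le (((continuous_eval_const (⟨0, by simp⟩ : Set.Icc (0:ℝ) 1)).comp
        continuous_curveRestrict).norm) continuous_const
    rw [Measure.map_apply hm hcl.measurableSet]
    exact (UnitSpeedCurve.isCompact_setOf_extend_zero_norm_le (n : ℝ)).measure_lt_top
  · refine Set.eq_univ_of_forall fun γ => Set.mem_iUnion.2 ?_
    exact exists_nat_ge ‖γ.1 0‖
  · have haes : AEStronglyMeasurable (fun γ : Curve d => curvePair γ.1 Φ + curveOcc γ.1 f)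
        (η.map UnitSpeedCurve.toCurve) := by
      have := (continuousOn_action hΦ hΦc hf).aestronglyMeasurable
        (μ := η.map UnitSpeedCurve.toCurve) measurableSet_unitSpeedSet
      rwa [Measure.restrict_eq_self_of_ae_mem hmem] at this
    refine ⟨(integrable_map_measure haes hm.aemeasurable).2 ?_, ?_⟩
    · exact (UnitSpeedCurve.continuous_action hΦ hΦc hf).integrable_of_hasCompactSupport
        (UnitSpeedCurve.hasCompactSupport_action hΦc hfc)
    · rw [integral_map hm.aemeasurable haes]
      exact hηint Φ f hΦ hΦc hf hfc

lemma ae_eq_zero_of_forall_exists_integral_le {α : Type*} [MeasurableSpace α] {μ : Measure α}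
    {g : α → ℝ} (hg0 : ∀ᵐ x ∂μ, 0 ≤ g x)
    (h : ∀ ε > 0, ∃ k : α → ℝ, Integrable k μ ∧ (∀ᵐ x ∂μ, g x ≤ k x) ∧ ∫ x, k x ∂μ ≤ ε) :
    ∀ᵐ x ∂μ, g x = 0 := by
  choose! k hk hgk hkε using fun n : ℕ => h (1 / ((n : ℝ) + 1)) (by positivity)
  let K : α → ℝ≥0∞ := fun x => ⨅ n, ENNReal.ofReal (k n x)
  have hKm : AEMeasurable K μ := AEMeasurable.iInf fun n => (hk n).aemeasurable.ennreal_ofReal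
  have hK : ∫⁻ x, K x ∂μ = 0 := by
    have hle : ∀ n : ℕ, ∫⁻ x, K x ∂μ ≤ ENNReal.ofReal (1 / ((n : ℝ) + 1)) := by
      intro n
      refine (lintegral_mono fun x => iInf_le _ n).trans ?_
      rw [← ofReal_integral_eq_lintegral_ofReal (hk n)
        (by filter_upwards [hg0, hgk n] with x h1 h2 using h1.trans h2)]
      exact ENNReal.ofReal_le_ofReal (hkε n)
    have hlim := ENNReal.tendsto_ofReal (tendsto_one_div_add_atTop_nhds_zero_nat (𝕜 := ℝ))
    rw [ENNReal.ofReal_zero] at hlim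
    exact le_antisymm (ge_of_tendsto' hlim hle) zero_le
  rw [lintegral_eq_zero_iff' hKm] at hK
  filter_upwards [hK, hg0, ae_all_iff.2 hgk] with x hx h0 hgx
  refine le_antisymm ?_ h0
  rw [← ENNReal.ofReal_eq_zero, ← le_zero_iff]
  exact (le_iInf fun n => ENNReal.ofReal_le_ofReal (hgx n)).trans hx.le

end Assembly

/-- **Reparametrization lemma**: if a divergence-free `μ ∈ M(ℝ^d;ℝ^d)` is decomposed by a
finite measure `ξ` on `M(ℝ^d;ℝ^d)` concentrated on normalized curve-induced measures
`{μ_γ/‖μ_γ‖ : μ_γ ≠ 0} ∪ {0}`, then it is decomposed by a σ-finite measure `η` on `Γ`. -/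
theorem reparametrization
    {d : ℕ} (σμ : Measure (Ed d)) [IsFiniteMeasure σμ]
    (τ : Ed d → Ed d) (hτm : Measurable τ) (hτ1 : ∀ᵐ x ∂σμ, ‖τ x‖ = 1)
    (hdiv : ∀ φ : Ed d → ℝ, ContDiff ℝ (⊤ : ℕ∞) φ → HasCompactSupport φ →
      ∫ x, fderiv ℝ φ x (τ x) ∂σμ = 0)
    (ξ : Measure (VecMeas d)) [IsFiniteMeasure ξ]
    -- ξ is concentrated on `F(𝔭(Γ)) = {μ_γ/‖μ_γ‖ : μ_γ ≠ 0} ∪ {0}`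
    (hconc : ξ {ν : VecMeas d |
      ¬ (ν.pos = 0 ∨ ∃ γ : ℝ → Ed d, IsLip γ ∧ ∃ c : ℝ, 0 < c ∧ ν.pos Set.univ = 1 ∧
          ∀ Φ : Ed d → Ed d, Continuous Φ → HasCompactSupport Φ →
            ν.pair Φ = c * curvePair γ Φ)} = 0)
    -- μ = ∫ ν dξ(ν)
    (h1 : ∀ Φ : Ed d → Ed d, Continuous Φ → HasCompactSupport Φ →
      ∫ x, ⟪Φ x, τ x⟫ ∂σμ = ∫ ν, VecMeas.pair ν Φ ∂ξ)
    -- |μ| = ∫ |ν| dξ(ν)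
    (h2 : ∀ f : Ed d → ℝ, Continuous f → HasCompactSupport f → (∀ x, 0 ≤ f x) →
      ∫ x, f x ∂σμ = ∫ ν, (∫ x, f x ∂ν.pos) ∂ξ) :
    ∃ η : Measure (Curve d), SigmaFinite η ∧
      (∀ Φ : Ed d → Ed d, Continuous Φ → HasCompactSupport Φ →
        ∫ x, ⟪Φ x, τ x⟫ ∂σμ = ∫ γ, curvePair γ.1 Φ ∂η) ∧
      (∀ f : Ed d → ℝ, Continuous f → HasCompactSupport f → (∀ x, 0 ≤ f x) →
        ∫ x, f x ∂σμ = ∫ γ, curveMass γ.1 f ∂η) := by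
  obtain ⟨η, hη, hmem, h_int⟩ := exists_curve_superposition hτm hτ1 hdiv
  have hpair : ∀ Φ : Ed d → Ed d, Continuous Φ → HasCompactSupport Φ →
      Integrable (fun γ : Curve d => curvePair γ.1 Φ) η ∧
        ∫ γ, curvePair γ.1 Φ ∂η = ∫ x, ⟪Φ x, τ x⟫ ∂σμ := fun Φ hΦ hΦc => by
    simpa [curveOcc] using h_int Φ 0 hΦ hΦc continuous_const HasCompactSupport.zero
  have hocc : ∀ f : Ed d → ℝ, Continuous f → HasCompactSupport f →
      Integrable (fun γ : Curve d => curveOcc γ.1 f) η ∧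
        ∫ γ, curveOcc γ.1 f ∂η = ∫ x, f x ∂σμ := fun f hf hfc => by
    simpa [curvePair] using h_int 0 f continuous_const HasCompactSupport.zero hf hfc
  refine ⟨η, hη, fun Φ hΦ hΦc => (hpair Φ hΦ hΦc).2.symm, fun f hf hfc hf0 => ?_⟩
  rw [← (hocc f hf hfc).2]
  have hfint : Integrable f σμ := hf.integrable_of_hasCompactSupport hfc
  have hfτ : Integrable (fun x => f x • τ x) σμ := by
    refine hfint.mono (hf.measurable.smul hτm).aestronglyMeasurable ?_
    filter_upwards [hτ1] with x hx
    rw [norm_smul, hx, mul_one]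
  have hae : ∀ᵐ γ ∂η, curveOcc γ.1 f - curveMass γ.1 f = 0 := by
    refine ae_eq_zero_of_forall_exists_integral_le ?_ fun ε hε => ?_
    · filter_upwards [hmem] with γ hγ
      exact sub_nonneg.2 (curveMass_le_of_mem hγ hf hf0).1
    obtain ⟨Φ, hΦc, hΦε, hΦ, hΦint⟩ := hfτ.exists_hasCompactSupport_integral_sub_le (half_pos hε)
    have hgc : Continuous fun x => |‖Φ x‖ - f x| := (hΦ.norm.sub hf).abs
    have hgs : HasCompactSupport fun x => |‖Φ x‖ - f x| :=
      (hΦc.norm.sub hfc).comp_left abs_zero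
    obtain ⟨hP, hPe⟩ := hpair Φ hΦ hΦc
    obtain ⟨hA, hAe⟩ := hocc f hf hfc
    obtain ⟨hG, hGe⟩ := hocc _ hgc hgs
    refine ⟨fun γ => (curveOcc γ.1 f - curvePair γ.1 Φ) + curveOcc γ.1 fun x => |‖Φ x‖ - f x|,
      (hA.sub hP).add hG, ?_, ?_⟩
    · filter_upwards [hmem] with γ hγ
      linarith [(curveMass_le_of_mem hγ hf hf0).2 Φ hΦ]
    · refine (integral_add (hA.sub hP) hG).trans_le ?_
      refine (congrArg₂ (· + ·) ((integral_sub hA hP).trans (congrArg₂ (· - ·) hAe hPe))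
        hGe).trans_le ?_
      have hΦτ : Integrable (fun x => ⟪Φ x, τ x⟫) σμ := by
        refine hΦint.norm.mono (hΦ.measurable.inner hτm).aestronglyMeasurable ?_
        filter_upwards [hτ1] with x hx
        refine (norm_inner_le_norm _ _).trans_eq ?_
        rw [hx, mul_one, norm_norm]
      have hgint : Integrable (fun x => |‖Φ x‖ - f x|) σμ :=
        hgc.integrable_of_hasCompactSupport hgs
      have hdiff := (hfτ.sub hΦint).norm
      refine ((integral_add (hfint.sub hΦτ) hgint).trans
        (congrArg (· + _) (integral_sub hfint hΦτ))).ge.trans ?_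
      calc _ ≤ ∫ x, 2 * ‖f x • τ x - Φ x‖ ∂σμ := by
            refine integral_mono_ae ((hfint.sub hΦτ).add hgint) (hdiff.const_mul 2) ?_
            filter_upwards [hτ1] with x hx
            have h1 : f x - ⟪Φ x, τ x⟫ ≤ ‖f x • τ x - Φ x‖ := by
              have h3 : ⟪f x • τ x - Φ x, τ x⟫ = f x - ⟪Φ x, τ x⟫ := by
                rw [inner_sub_left, real_inner_smul_left, real_inner_self_eq_norm_sq, hx]
                ring
              rw [← h3]
              refine (real_inner_le_norm _ _).trans_eq ?_
              rw [hx, mul_one]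
            have h2 : |‖Φ x‖ - f x| ≤ ‖f x • τ x - Φ x‖ := by
              have h3 : ‖f x • τ x‖ = f x := by
                rw [norm_smul, hx, mul_one, Real.norm_of_nonneg (hf0 x)]
              rw [norm_sub_rev]
              simpa [h3] using abs_norm_sub_norm_le (Φ x) (f x • τ x)
            simp only [Pi.sub_apply]
            linarith
        _ = 2 * ∫ x, ‖f x • τ x - Φ x‖ ∂σμ := integral_const_mul _ _
        _ ≤ ε := by linarith
  refine integral_congr_ae ?_
  filter_upwards [hae] with γ hγ
  exact sub_eq_zero.1 hγ
end
end

section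
/- Let μ ∈ M(ℝ^d;ℝ^d). A measure σ ∈ M(ℝ^d;ℝ^d) is a subcurrent of μ (i.e. ‖μ‖ = ‖μ − σ‖ + ‖σ‖) if and only if σ = g μ for some g ∈ L¹(|μ|) with 0 ≤ g(x) ≤ 1 for |μ|-a.e. x ∈ ℝ^d. -/
open MeasureTheory Filter
open scoped ENNReal NNReal

noncomputable section

/-- In a strictly convex space, if the triangle inequality for `a = (a - b) + b` is an equality,
then `b` is the multiple of `a` by the ratio of the norms. -/
theorem eq_norm_div_norm_smul_of_norm_eq_norm_sub_add_norm {E : Type*} [NormedAddCommGroup E]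
    [NormedSpace ℝ E] [StrictConvexSpace ℝ E] {a b : E} (h : ‖a‖ = ‖a - b‖ + ‖b‖) :
    b = (‖b‖ / ‖a‖) • a := by
  rcases eq_or_ne a 0 with rfl | ha
  · have hb : ‖b‖ = 0 := by
      have := norm_nonneg b
      simp only [norm_zero, zero_sub, norm_neg] at h
      linarith
    simpa using hb
  · have hray : SameRay ℝ (a - b) b :=
      sameRay_iff_norm_add.2 (by rwa [sub_add_cancel])
    have hab : SameRay ℝ a b := by
      simpa using hray.add_left (SameRay.refl b)
    have hsmul : ‖a‖ • b = ‖b‖ • a := hab.norm_smul_eq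
    rw [div_eq_inv_mul, mul_smul, ← hsmul, inv_smul_smul₀ (norm_ne_zero_iff.2 ha)]

theorem norm_eq_norm_sub_smul_add_norm_smul {E : Type*} [NormedAddCommGroup E]
    [NormedSpace ℝ E] (a : E) {t : ℝ} (h0 : 0 ≤ t) (h1 : t ≤ 1) :
    ‖a‖ = ‖a - t • a‖ + ‖t • a‖ := by
  have hsub : a - t • a = (1 - t) • a := by rw [sub_smul, one_smul]
  rw [hsub, norm_smul, norm_smul, Real.norm_of_nonneg h0, Real.norm_of_nonneg (sub_nonneg.2 h1)]
  ring

/-- **Characterization of subcurrents.** Writing the finite vector measures `μ = F·λ` and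
`σ = G·λ` with densities w.r.t. a common finite positive measure `λ` (so that
`‖μ‖ = ∫‖F‖ dλ`, `‖σ‖ = ∫‖G‖ dλ` and `‖μ - σ‖ = ∫‖F - G‖ dλ`), `σ` is a subcurrent of `μ`,
i.e. `‖μ‖ = ‖μ - σ‖ + ‖σ‖`, iff `σ = g μ` for some `g` with `0 ≤ g ≤ 1`  `|μ|`-a.e. -/
theorem subcurrent_iff_density {d : ℕ}
    (lam : Measure (Ed d)) [IsFiniteMeasure lam]
    (F G : Ed d → Ed d) (hF : Integrable F lam) (hG : Integrable G lam) :
    (∫ x, ‖F x‖ ∂lam = (∫ x, ‖F x - G x‖ ∂lam) + ∫ x, ‖G x‖ ∂lam) ↔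
      ∃ g : Ed d → ℝ, Measurable g ∧ (∀ᵐ x ∂lam, 0 ≤ g x ∧ g x ≤ 1) ∧
        ∀ᵐ x ∂lam, G x = g x • F x := by
  have hsub : Integrable (fun x => ‖F x - G x‖) lam := (hF.sub hG).norm
  have hFG : Integrable (fun x => ‖F x - G x‖ + ‖G x‖) lam := hsub.add hG.norm
  rw [← integral_add hsub hG.norm]
  constructor
  · intro h
    have hle : (fun x => ‖F x‖) ≤ᵐ[lam] fun x => ‖F x - G x‖ + ‖G x‖ :=
      .of_forall fun x => (norm_le_norm_add_norm_sub' (F x) (G x)).trans_eq (add_comm _ _)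
    have hae := (integral_eq_iff_of_ae_le hF.norm hFG hle).1 h
    have hFm := hF.aestronglyMeasurable.norm.aemeasurable
    have hGm := hG.aestronglyMeasurable.norm.aemeasurable
    have hgm := hGm.div hFm
    refine ⟨hgm.mk _, hgm.measurable_mk, ?_, ?_⟩
    · filter_upwards [hae, hgm.ae_eq_mk] with x hx hg
      rw [← hg]
      refine ⟨div_nonneg (norm_nonneg _) (norm_nonneg _), div_le_one_of_le₀ ?_ (norm_nonneg _)⟩
      have := norm_nonneg (F x - G x)
      linarith
    · filter_upwards [hae, hgm.ae_eq_mk] with x hx hg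
      rw [← hg]
      exact eq_norm_div_norm_smul_of_norm_eq_norm_sub_add_norm hx
  · rintro ⟨g, -, hg, hGg⟩
    refine integral_congr_ae ?_
    filter_upwards [hg, hGg] with x hx hGx
    rw [hGx]
    exact norm_eq_norm_sub_smul_add_norm_smul (F x) hx.1 hx.2
end
end
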